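/- arXiv:1405.5190 — 5 statements merged into one kernel-verified Lean document; each statement's English description precedes it below -/
import Mathlib

section
/- Let n ≥ 2 and let f : ℝ_{>0}^n → ℝ_{>0} be a quasi-sum production function, f(x_1,…,x_n) = G(h_1(x_1)+…+h_n(x_n)), where G and the h_j are twice differentiable strictly monotone real functions with G' > 0. Fix an index i. Then the elasticity of production with respect to the factor x_i is a constant k_i (i.e. (x_i/f(x))·∂f/∂x_i(x) = k_i for all x in the domain) if and only if f reduces to f(x_1,…,x_n) = A · x_i^{k_i} · exp(D · Σ_{j≠i} h_j(x_j)) for some positive constants A and D. -/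
/-- Partial derivative of `f : ℝⁿ → ℝ` with respect to the `i`-th coordinate at `x`. -/
noncomputable def pd {n : ℕ} (f : (Fin n → ℝ) → ℝ) (i : Fin n) (x : Fin n → ℝ) : ℝ :=
  deriv (fun t => f (Function.update x i t)) (x i)

open Finset in
/-- Updating one argument of a separable sum only changes the corresponding summand. -/
theorem sum_apply_update {n : ℕ} (h : Fin n → ℝ → ℝ) (x : Fin n → ℝ) (j : Fin n) (t : ℝ) :
    ∑ m, h m (Function.update x j t m) = h j t + ∑ m ∈ univ.erase j, h m (x m) := by
  rw [← add_sum_erase univ _ (mem_univ j), Function.update_self]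
  congr 1
  refine sum_congr rfl fun m hm => ?_
  rw [Function.update_of_ne (ne_of_mem_erase hm)]

theorem update_pos {n : ℕ} {x : Fin n → ℝ} (hx : ∀ m, 0 < x m) (j : Fin n) {t : ℝ}
    (ht : 0 < t) (m : Fin n) : 0 < Function.update x j t m := by
  rcases eq_or_ne m j with rfl | hm
  · simpa using ht
  · simpa [hm] using hx m

/-- Chain rule for a function of a separable sum in one coordinate. -/
theorem HasDerivAt.comp_sum_update {n : ℕ} {h : Fin n → ℝ → ℝ} {x : Fin n → ℝ} {j : Fin n}
    {F : ℝ → ℝ} {F' h' : ℝ} (hF : HasDerivAt F F' (∑ m, h m (x m)))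
    (hh : HasDerivAt (h j) h' (x j)) :
    HasDerivAt (fun t => F (∑ m, h m (Function.update x j t m))) (F' * h') (x j) := by
  have hsum : HasDerivAt (fun t => ∑ m, h m (Function.update x j t m)) h' (x j) := by
    simp only [sum_apply_update]
    exact hh.add_const _
  refine HasDerivAt.comp (x j) ?_ hsum
  simpa using hF

theorem eq_of_hasDerivAt_zero_Ioi {g : ℝ → ℝ} (hg : ∀ t, 0 < t → HasDerivAt g 0 t) {s t : ℝ}
    (hs : 0 < s) (ht : 0 < t) : g s = g t :=
  isOpen_Ioi.is_const_of_deriv_eq_zero isPreconnected_Ioi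
    (fun r hr => (hg r hr).differentiableAt.differentiableWithinAt)
    (fun r hr => (hg r hr).deriv) (Set.mem_Ioi.2 hs) (Set.mem_Ioi.2 ht)

theorem exists_deriv_ne_zero_of_injOn_Ioi {g : ℝ → ℝ}
    (hg : ∀ t, 0 < t → DifferentiableAt ℝ g t) (hinj : Set.InjOn g (Set.Ioi 0)) :
    ∃ t, 0 < t ∧ deriv g t ≠ 0 := by
  by_contra! hzero
  have := hinj (Set.mem_Ioi.2 one_pos) (Set.mem_Ioi.2 two_pos)
    (eq_of_hasDerivAt_zero_Ioi (fun t ht => hzero t ht ▸ (hg t ht).hasDerivAt) one_pos two_pos)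
  norm_num at this

/-- The range of a separable sum of continuous functions on the positive orthant is convex. -/
theorem convex_image_sum {n : ℕ} {h : Fin n → ℝ → ℝ}
    (hh : ∀ j, ContinuousOn (h j) (Set.Ioi 0)) :
    Convex ℝ ((fun x : Fin n → ℝ => ∑ m, h m (x m)) '' {x | ∀ m, 0 < x m}) := by
  have hconv : Convex ℝ {x : Fin n → ℝ | ∀ m, 0 < x m} := by
    intro x hx y hy a b ha hb hab m
    exact (convex_Ioi (0 : ℝ)) (hx m) (hy m) ha hb hab
  refine (hconv.isPreconnected.image _ ?_).ordConnected.convex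
  exact continuousOn_finsetSum _ fun m _ =>
    (hh m).comp (continuous_apply m).continuousOn fun x hx => hx m

theorem Convex.eq_of_hasDerivAt_zero {s : Set ℝ} (hs : Convex ℝ s) {g : ℝ → ℝ}
    (hg : ∀ u ∈ s, HasDerivAt g 0 u) {a b : ℝ} (ha : a ∈ s) (hb : b ∈ s) : g a = g b := by
  have := hs.norm_image_sub_le_of_norm_hasDerivWithin_le (C := 0)
    (fun u hu => (hg u hu).hasDerivWithinAt) (by simp) hb ha
  simpa [sub_eq_zero] using this

/-- The partial derivatives of a quasi-sum. -/
theorem pd_quasiSum {n : ℕ} {G : ℝ → ℝ} {h : Fin n → ℝ → ℝ} {f : (Fin n → ℝ) → ℝ}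
    (hf : ∀ x : Fin n → ℝ, (∀ j, 0 < x j) → f x = G (∑ j, h j (x j)))
    (hG : Differentiable ℝ G) {i : Fin n}
    (hh : ∀ t : ℝ, 0 < t → DifferentiableAt ℝ (h i) t)
    {x : Fin n → ℝ} (hx : ∀ j, 0 < x j) :
    pd f i x = deriv G (∑ j, h j (x j)) * deriv (h i) (x i) := by
  have hslice := (hG (∑ j, h j (x j))).hasDerivAt.comp_sum_update (hh _ (hx i)).hasDerivAt
  refine HasDerivAt.deriv (hslice.congr_of_eventuallyEq ?_)
  filter_upwards [lt_mem_nhds (hx i)] with t ht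
  exact hf _ (update_pos hx i ht)

theorem elasticity_of_power {n : ℕ} {f : (Fin n → ℝ) → ℝ} {i : Fin n} {k : ℝ}
    {c : (Fin n → ℝ) → ℝ} {x : Fin n → ℝ} (hx : ∀ j, 0 < x j) (hc : c x ≠ 0)
    (hupd : ∀ t, c (Function.update x i t) = c x)
    (hf : ∀ y : Fin n → ℝ, (∀ j, 0 < y j) → f y = c y * (y i) ^ k) :
    (x i / f x) * pd f i x = k := by
  have hxi := hx i
  have hpd : pd f i x = c x * (k * (x i) ^ (k - 1)) := by
    have hpow := (Real.hasDerivAt_rpow_const (p := k) (Or.inl hxi.ne')).const_mul (c x)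
    refine HasDerivAt.deriv (hpow.congr_of_eventuallyEq ?_)
    filter_upwards [lt_mem_nhds hxi] with t ht
    simp [hf _ (update_pos hx i ht), hupd]
  have hne := (Real.rpow_pos_of_pos hxi k).ne'
  rw [hpd, hf x hx, Real.rpow_sub_one hxi.ne']
  field_simp

/-- If a quasi-sum has constant elasticity in `x i`, then the logarithmic derivative of its outer
function is constant along the whole range of the inner sum. -/
theorem exists_logDeriv_eq_of_constant_elasticity {n : ℕ} (hn : 2 ≤ n)
    {G : ℝ → ℝ} {h : Fin n → ℝ → ℝ}
    (hGpos : ∀ x : Fin n → ℝ, (∀ j, 0 < x j) → 0 < G (∑ j, h j (x j)))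
    (hG : Differentiable ℝ G) (hG2 : Differentiable ℝ (deriv G)) (hG' : ∀ u, 0 < deriv G u)
    (hh : ∀ j, ∀ t : ℝ, 0 < t → DifferentiableAt ℝ (h j) t)
    (hinj : ∀ j, Set.InjOn (h j) (Set.Ioi 0)) {i : Fin n} {k : ℝ}
    (hel : ∀ x : Fin n → ℝ, (∀ j, 0 < x j) →
      logDeriv G (∑ j, h j (x j)) * (x i * deriv (h i) (x i)) = k) :
    ∃ D, 0 < D ∧ ∀ x : Fin n → ℝ, (∀ j, 0 < x j) → logDeriv G (∑ j, h j (x j)) = D := by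
  have hpos : ∀ x : Fin n → ℝ, (∀ j, 0 < x j) → 0 < logDeriv G (∑ j, h j (x j)) :=
    fun x hx => by rw [logDeriv_apply]; exact div_pos (hG' _) (hGpos x hx)
  have hk : k ≠ 0 := by
    obtain ⟨t, ht, hne⟩ := exists_deriv_ne_zero_of_injOn_Ioi (hh i) (hinj i)
    rw [← hel (fun _ => t) fun _ => ht]
    exact mul_ne_zero (hpos (fun _ => t) fun _ => ht).ne' (mul_ne_zero ht.ne' hne)
  have hne : ∀ x : Fin n → ℝ, (∀ j, 0 < x j) → x i * deriv (h i) (x i) ≠ 0 :=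
    fun x hx h0 => hk (by rw [← hel x hx, h0, mul_zero])
  have : Nontrivial (Fin n) := Fin.nontrivial_iff_two_le.2 hn
  obtain ⟨j, hji⟩ := exists_ne i
  obtain ⟨y, hy, hyne⟩ := exists_deriv_ne_zero_of_injOn_Ioi (hh j) (hinj j)
  have hcrit : ∀ x : Fin n → ℝ, (∀ m, 0 < x m) → x j = y →
      HasDerivAt (logDeriv G) 0 (∑ m, h m (x m)) := by
    intro x hx hxj
    have hdiff : DifferentiableAt ℝ (logDeriv G) (∑ m, h m (x m)) :=
      (hG2 _).div (hG _) (hGpos x hx).ne'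
    have hslice := hdiff.hasDerivAt.comp_sum_update (hh j _ (hx j)).hasDerivAt
    have hconst : HasDerivAt (fun t => logDeriv G (∑ m, h m (Function.update x j t m))) 0 (x j) := by
      refine (hasDerivAt_const (x j) (k / (x i * deriv (h i) (x i)))).congr_of_eventuallyEq ?_
      filter_upwards [lt_mem_nhds (hx j)] with t ht
      have := hel _ (update_pos hx j ht)
      rw [Function.update_of_ne hji.symm] at this
      exact eq_div_of_mul_eq (hne x hx) this
    have hzero : deriv (logDeriv G) (∑ m, h m (x m)) = 0 :=
      (mul_eq_zero.1 (hslice.unique hconst)).resolve_right (hxj ▸ hyne)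
    exact hzero ▸ hdiff.hasDerivAt
  set z : Fin n → ℝ := Function.update (fun _ => 1) j y with hz
  have hzpos : ∀ m, 0 < z m := update_pos (fun _ => one_pos) j hy
  have hline : ∀ t, 0 < t →
      logDeriv G (∑ m, h m (Function.update z i t m)) = logDeriv G (∑ m, h m (z m)) := by
    intro t ht
    have := eq_of_hasDerivAt_zero_Ioi
      (g := fun t => logDeriv G (∑ m, h m (Function.update z i t m))) (fun s hs => ?_) ht (hzpos i)
    · simpa using this
    · have hw := update_pos hzpos i hs
      have hs' := (hcrit _ hw (by simp [hji, hz])).comp_sum_update (j := i)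
        (hh i _ (hw i)).hasDerivAt
      simpa using hs'
  refine ⟨_, hpos z hzpos, fun x hx => mul_right_cancel₀ (hne x hx) ?_⟩
  have := hel _ (update_pos hzpos i (hx i))
  rw [Function.update_self, hline _ (hx i)] at this
  rw [hel x hx, this]

/-- Solutions of the differential equation `D * t * g' t = k` on the positive half-line. -/
theorem mul_eq_log_add_of_mul_deriv_eq {g : ℝ → ℝ} {k D : ℝ}
    (hg : ∀ t : ℝ, 0 < t → DifferentiableAt ℝ g t)
    (hode : ∀ t : ℝ, 0 < t → D * (t * deriv g t) = k) {t : ℝ} (ht : 0 < t) :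
    D * g t = k * Real.log t + D * g 1 := by
  have := eq_of_hasDerivAt_zero_Ioi (g := fun t => D * g t - k * Real.log t) (fun s hs => ?_)
    ht one_pos
  · simp only [Real.log_one] at this
    linarith
  · refine (((hg s hs).hasDerivAt.const_mul D).sub
      ((Real.hasDerivAt_log hs.ne').const_mul k)).congr_deriv ?_
    rw [← hode s hs]
    field_simp
    ring

/-- A quasi-sum production function `f(x) = G(h₁(x₁)+⋯+hₙ(xₙ))` has constant elasticity
of production `kᵢ` with respect to the factor `xᵢ` iff it reduces to
`f(x) = A · xᵢ^{kᵢ} · exp(D · ∑_{j≠i} hⱼ(xⱼ))` with constants `A, D > 0`. -/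
theorem quasiSum_constant_elasticity_iff
    (n : ℕ) (hn : 2 ≤ n)
    (G : ℝ → ℝ) (h : Fin n → ℝ → ℝ) (f : (Fin n → ℝ) → ℝ)
    (hf : ∀ x : Fin n → ℝ, (∀ j, 0 < x j) → f x = G (∑ j, h j (x j)))
    (hfpos : ∀ x : Fin n → ℝ, (∀ j, 0 < x j) → 0 < f x)
    (hGdiff : Differentiable ℝ G)
    (hGdiff2 : Differentiable ℝ (deriv G))
    (hGmono : StrictMono G)
    (hG' : ∀ u : ℝ, 0 < deriv G u)
    (hhdiff : ∀ j, ∀ t : ℝ, 0 < t → DifferentiableAt ℝ (h j) t)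
    (hhdiff2 : ∀ j, ∀ t : ℝ, 0 < t → DifferentiableAt ℝ (deriv (h j)) t)
    (hhmono : ∀ j, StrictMonoOn (h j) (Set.Ioi 0) ∨ StrictAntiOn (h j) (Set.Ioi 0))
    (i : Fin n) (ki : ℝ) :
    (∀ x : Fin n → ℝ, (∀ j, 0 < x j) → (x i / f x) * pd f i x = ki)
      ↔ ∃ A D : ℝ, 0 < A ∧ 0 < D ∧ ∀ x : Fin n → ℝ, (∀ j, 0 < x j) →
          f x = A * (x i) ^ ki *
            Real.exp (D * ∑ j ∈ Finset.univ.erase i, h j (x j)) := by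
  constructor
  · intro hconst
    have hGpos : ∀ x : Fin n → ℝ, (∀ j, 0 < x j) → 0 < G (∑ j, h j (x j)) :=
      fun x hx => hf x hx ▸ hfpos x hx
    have hel : ∀ x : Fin n → ℝ, (∀ j, 0 < x j) →
        logDeriv G (∑ j, h j (x j)) * (x i * deriv (h i) (x i)) = ki := by
      intro x hx
      rw [← hconst x hx, pd_quasiSum hf hGdiff (hhdiff i) hx, hf x hx, logDeriv_apply]
      ring
    obtain ⟨D, hD, hlog⟩ := exists_logDeriv_eq_of_constant_elasticity hn hGpos hGdiff hGdiff2 hG'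
      hhdiff (fun j => (hhmono j).elim StrictMonoOn.injOn StrictAntiOn.injOn) hel
    have hhi : ∀ t, 0 < t → D * h i t = ki * Real.log t + D * h i 1 := fun t ht =>
      mul_eq_log_add_of_mul_deriv_eq (hhdiff i)
        (fun s hs => by
          rw [← hel (fun _ => s) fun _ => hs, hlog _ fun _ => hs]) ht
    have hGexp : ∀ x : Fin n → ℝ, (∀ j, 0 < x j) →
        Real.log (G (∑ j, h j (x j))) - D * ∑ j, h j (x j) =
          Real.log (G (∑ j, h j 1)) - D * ∑ j, h j 1 := by
      intro x hx
      refine (convex_image_sum fun j => fun t ht =>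
        (hhdiff j t ht).continuousAt.continuousWithinAt).eq_of_hasDerivAt_zero
        (g := fun u => Real.log (G u) - D * u) ?_ ⟨x, hx, rfl⟩ ⟨fun _ => 1, fun _ => one_pos, rfl⟩
      rintro _ ⟨w, hw, rfl⟩
      refine (((hGdiff _).hasDerivAt.log (hGpos w hw).ne').sub
        ((hasDerivAt_id _).const_mul D)).congr_deriv ?_
      rw [← logDeriv_apply, hlog w hw]
      ring
    refine ⟨Real.exp (Real.log (G (∑ j, h j 1)) - D * ∑ j, h j 1 + D * h i 1), D,
      Real.exp_pos _, hD, fun x hx => ?_⟩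
    rw [Real.rpow_def_of_pos (hx i), ← Real.exp_add, ← Real.exp_add, hf x hx,
      ← Real.exp_log (hGpos x hx)]
    congr 1
    have hsum := Finset.add_sum_erase Finset.univ (fun j => h j (x j)) (Finset.mem_univ i)
    have hmul : D * h i (x i) + D * ∑ j ∈ Finset.univ.erase i, h j (x j) =
        D * ∑ j, h j (x j) := by
      rw [← hsum, mul_add]
    linarith [hGexp x hx, hhi (x i) (hx i)]
  · rintro ⟨A, D, hA, -, hfx⟩ x hx
    refine elasticity_of_power
      (c := fun y => A * Real.exp (D * ∑ j ∈ Finset.univ.erase i, h j (y j)))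
      hx (mul_pos hA (Real.exp_pos _)).ne' (fun t => ?_)
      (fun y hy => by rw [hfx y hy]; ring)
    have hsum : ∑ j ∈ Finset.univ.erase i, h j (Function.update x i t j) =
        ∑ j ∈ Finset.univ.erase i, h j (x j) :=
      Finset.sum_congr rfl fun j hj => by rw [Function.update_of_ne (Finset.ne_of_mem_erase hj)]
    simp only [hsum]
end

section
/- Let n ≥ 2, let k be a nonzero real number, let G be a twice differentiable strictly monotone real function with G' > 0, and suppose h_i(t) = k·ln t + C_i for constants C_i, i = 1,…,n. Let f(x) = G(h_1(x_1)+…+h_n(x_n)) on ℝ_{>0}^n. Then the Hessian determinant of f vanishes identically if and only if G satisfies G''(u)/G'(u) = 1/(nk) on the relevant range, in which case G(u) = C·n·k·e^{u/(nk)} + D for some constants C > 0 and D ∈ ℝ. -/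
/-- Second partial derivative `∂²f/∂xⱼ∂xᵢ` at `x`. -/
noncomputable def pd2 {n : ℕ} (f : (Fin n → ℝ) → ℝ) (i j : Fin n) (x : Fin n → ℝ) : ℝ :=
  pd (pd f i) j x

open Filter Topology in
/-- Changing one coordinate slightly keeps a positive vector positive. -/
lemma eventually_update_pos {n : ℕ} {x : Fin n → ℝ} (hx : ∀ j, 0 < x j) (i : Fin n) :
    ∀ᶠ t in 𝓝 (x i), ∀ j, 0 < Function.update x i t j := by
  filter_upwards [lt_mem_nhds (hx i)] with t ht j
  rcases eq_or_ne j i with rfl | hj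
  · simpa using ht
  · simpa [hj] using hx j

lemma hasDerivAt_update_apply {n : ℕ} (x : Fin n → ℝ) (i j : Fin n) :
    HasDerivAt (fun t => Function.update x i t j) (if j = i then 1 else 0) (x i) := by
  rcases eq_or_ne j i with rfl | hj
  · simpa using hasDerivAt_id' (x j)
  · simpa [hj] using hasDerivAt_const (x i) (x j)

lemma hasDerivAt_sum_log_update {n : ℕ} (k : ℝ) (C : Fin n → ℝ) {x : Fin n → ℝ}
    (hx : ∀ j, 0 < x j) (i : Fin n) :
    HasDerivAt (fun t => ∑ j, (k * Real.log (Function.update x i t j) + C j))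
      (k / x i) (x i) := by
  have key : ∀ j ∈ Finset.univ,
      HasDerivAt (fun t => k * Real.log (Function.update x i t j) + C j)
        (k * ((if j = i then 1 else 0) / x j)) (x i) := by
    intro j _
    have := (((hasDerivAt_update_apply x i j).log (by simpa using (hx j).ne')).const_mul
      k).add_const (C j)
    simpa using this
  refine (HasDerivAt.fun_sum key).congr_deriv ?_
  rw [Finset.sum_eq_single i (fun j _ hj => by simp [hj]) (by simp)]
  simp [div_eq_mul_inv]

section LogSum

variable {n : ℕ} {k : ℝ} {C : Fin n → ℝ} {G : ℝ → ℝ} {f : (Fin n → ℝ) → ℝ} {x : Fin n → ℝ}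

lemma pd_comp_sum_log
    (hf : ∀ x : Fin n → ℝ, (∀ j, 0 < x j) → f x = G (∑ j, (k * Real.log (x j) + C j)))
    (hG : Differentiable ℝ G) (hx : ∀ j, 0 < x j) (i : Fin n) :
    pd f i x = deriv G (∑ j, (k * Real.log (x j) + C j)) * (k / x i) := by
  have hcomp := (hG _).hasDerivAt.comp (x i) (hasDerivAt_sum_log_update k C hx i)
  simp only [Function.update_eq_self] at hcomp
  refine (hcomp.congr_of_eventuallyEq ?_).deriv
  filter_upwards [eventually_update_pos hx i] with t ht
  exact hf _ ht

lemma pd2_comp_sum_log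
    (hf : ∀ x : Fin n → ℝ, (∀ j, 0 < x j) → f x = G (∑ j, (k * Real.log (x j) + C j)))
    (hG : Differentiable ℝ G) (hG2 : Differentiable ℝ (deriv G))
    (hx : ∀ j, 0 < x j) (i j : Fin n) :
    pd2 f i j x = deriv (deriv G) (∑ l, (k * Real.log (x l) + C l)) * (k / x j) * (k / x i)
      - deriv G (∑ l, (k * Real.log (x l) + C l)) * (k * (if i = j then 1 else 0) / x i ^ 2) := by
  have houter := (hG2 _).hasDerivAt.comp (x j) (hasDerivAt_sum_log_update k C hx j)
  have hinner := (hasDerivAt_const (x j) k).fun_div (hasDerivAt_update_apply x j i)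
    (by simpa using (hx i).ne')
  have hmul := houter.fun_mul hinner
  simp only [Function.update_eq_self, Function.comp_apply] at hmul
  have hderiv := (hmul.congr_of_eventuallyEq (f₁ := fun t => pd f i (Function.update x j t)) (by
    filter_upwards [eventually_update_pos hx j] with t ht
    exact pd_comp_sum_log hf hG ht i)).deriv
  rw [pd2, pd, hderiv]
  ring

lemma det_hessian_comp_sum_log
    (hf : ∀ x : Fin n → ℝ, (∀ j, 0 < x j) → f x = G (∑ j, (k * Real.log (x j) + C j)))
    (hG : Differentiable ℝ G) (hG2 : Differentiable ℝ (deriv G)) (hG' : ∀ u, 0 < deriv G u)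
    (hx : ∀ j, 0 < x j) :
    Matrix.det (Matrix.of fun i j => pd2 f i j x) =
      (∏ i, -(deriv G (∑ j, (k * Real.log (x j) + C j)) * k / x i ^ 2)) *
        (1 - n * k * (deriv (deriv G) (∑ j, (k * Real.log (x j) + C j)) /
          deriv G (∑ j, (k * Real.log (x j) + C j)))) := by
  have hpd2 := pd2_comp_sum_log hf hG hG2 hx
  have hg := (hG' (∑ j, (k * Real.log (x j) + C j))).ne'
  generalize (∑ j, (k * Real.log (x j) + C j)) = u at *
  have hfactor : (Matrix.of fun i j => pd2 f i j x) =
      Matrix.diagonal (fun i => -(deriv G u * k / x i ^ 2)) *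
        (1 + Matrix.replicateCol Unit (fun i => -(deriv (deriv G) u * k / deriv G u) * x i) *
          Matrix.replicateRow Unit (fun j => (x j)⁻¹)) := by
    ext i j
    have hi := (hx i).ne'
    have hj := (hx j).ne'
    rw [Matrix.diagonal_mul]
    simp only [Matrix.of_apply, hpd2, Matrix.add_apply, Matrix.one_apply,
      Matrix.mul_apply, Matrix.replicateCol_apply, Matrix.replicateRow_apply,
      Finset.univ_unique, Finset.sum_singleton]
    rcases eq_or_ne i j with rfl | hij
    · simp only [if_true]
      field_simp
      ring
    · simp only [hij, if_false]
      field_simp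
      ring
  rw [hfactor, Matrix.det_mul, Matrix.det_diagonal,
    Matrix.det_one_add_replicateCol_mul_replicateRow]
  congr 1
  have hdot : ∀ i, (x i)⁻¹ * (-(deriv (deriv G) u * k / deriv G u) * x i) =
      -(deriv (deriv G) u * k / deriv G u) := fun i => by
    have := (hx i).ne'
    field_simp
  simp only [dotProduct, hdot, Finset.sum_const, Finset.card_univ, Fintype.card_fin, nsmul_eq_mul]
  ring

end LogSum

/-- A solution of `G'' = G' / a` is an affine function of `exp (u / a)`. -/
lemma eq_exp_add_const_of_deriv_deriv {G : ℝ → ℝ} {a : ℝ} (ha : a ≠ 0)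
    (hG : Differentiable ℝ G) (hG2 : Differentiable ℝ (deriv G))
    (hode : ∀ u, deriv (deriv G) u = deriv G u / a) (u : ℝ) :
    G u = deriv G 0 * a * Real.exp (u / a) + (G 0 - deriv G 0 * a) := by
  have hexp : ∀ v, HasDerivAt (fun v => Real.exp (v / a)) (Real.exp (v / a) / a) v := fun v => by
    simpa [div_eq_mul_inv] using ((hasDerivAt_id v).div_const a).exp
  have hexp' : ∀ v, HasDerivAt (fun v => Real.exp (-(v / a))) (-(Real.exp (-(v / a)) / a)) v :=
    fun v => by simpa [div_eq_mul_inv] using ((hasDerivAt_id v).div_const a).fun_neg.exp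
  have hG1 : ∀ v, deriv G v = deriv G 0 * Real.exp (v / a) := by
    intro v
    have hd : ∀ w, HasDerivAt (fun w => deriv G w * Real.exp (-(w / a))) 0 w := fun w => by
      refine ((hG2 w).hasDerivAt.fun_mul (hexp' w)).congr_deriv ?_
      rw [hode]
      ring
    have := is_const_of_deriv_eq_zero (fun w => (hd w).differentiableAt) (fun w => (hd w).deriv) v 0
    simp only [zero_div, neg_zero, Real.exp_zero, mul_one] at this
    rw [← this, mul_assoc, ← Real.exp_add]
    simp
  have hd : ∀ w, HasDerivAt (fun w => G w - deriv G 0 * a * Real.exp (w / a)) 0 w := fun w => by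
    refine ((hG w).hasDerivAt.fun_sub ((hexp w).const_mul (deriv G 0 * a))).congr_deriv ?_
    rw [hG1 w]
    field_simp
    ring
  have := is_const_of_deriv_eq_zero (fun w => (hd w).differentiableAt) (fun w => (hd w).deriv) u 0
  simp only [zero_div, Real.exp_zero, mul_one] at this
  linarith

/-- For `f(x) = G(∑ᵢ (k·ln xᵢ + Cᵢ))` with `k ≠ 0` and `G' > 0`, the Hessian determinant
of `f` vanishes identically iff `G''/G' = 1/(nk)` on the relevant range, in which case
`G(u) = C·n·k·e^{u/(nk)} + D` with `C > 0`. -/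
theorem hessian_det_vanishes_iff_ode
    (n : ℕ) (hn : 2 ≤ n) (k : ℝ) (hk : k ≠ 0)
    (G : ℝ → ℝ) (C : Fin n → ℝ) (h : Fin n → ℝ → ℝ)
    (hh : ∀ i : Fin n, ∀ t : ℝ, 0 < t → h i t = k * Real.log t + C i)
    (f : (Fin n → ℝ) → ℝ)
    (hf : ∀ x : Fin n → ℝ, (∀ j, 0 < x j) → f x = G (∑ j, h j (x j)))
    (hGdiff : Differentiable ℝ G)
    (hGdiff2 : Differentiable ℝ (deriv G))
    (hGmono : StrictMono G)
    (hG' : ∀ u : ℝ, 0 < deriv G u) :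
    ((∀ x : Fin n → ℝ, (∀ j, 0 < x j) →
        Matrix.det (Matrix.of fun i j => pd2 f i j x) = 0)
      ↔ (∀ x : Fin n → ℝ, (∀ j, 0 < x j) →
          deriv (deriv G) (∑ j, h j (x j)) / deriv G (∑ j, h j (x j)) = 1 / (n * k)))
    ∧ ((∀ x : Fin n → ℝ, (∀ j, 0 < x j) →
          Matrix.det (Matrix.of fun i j => pd2 f i j x) = 0) →
        ∃ c d : ℝ, 0 < c ∧ ∀ x : Fin n → ℝ, (∀ j, 0 < x j) →
          G (∑ j, h j (x j)) = c * n * k * Real.exp ((∑ j, h j (x j)) / (n * k)) + d) := by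
  have hsum : ∀ x : Fin n → ℝ, (∀ j, 0 < x j) →
      ∑ j, h j (x j) = ∑ j, (k * Real.log (x j) + C j) := fun x hx =>
    Finset.sum_congr rfl fun j _ => hh j _ (hx j)
  have hf' : ∀ x : Fin n → ℝ, (∀ j, 0 < x j) → f x = G (∑ j, (k * Real.log (x j) + C j)) :=
    fun x hx => by rw [hf x hx, hsum x hx]
  have hn0 : (n : ℝ) ≠ 0 := by positivity
  have hnk : (n : ℝ) * k ≠ 0 := mul_ne_zero hn0 hk
  have hiff : ∀ x : Fin n → ℝ, (∀ j, 0 < x j) →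
      (Matrix.det (Matrix.of fun i j => pd2 f i j x) = 0 ↔
        deriv (deriv G) (∑ j, h j (x j)) / deriv G (∑ j, h j (x j)) = 1 / (n * k)) := by
    intro x hx
    have hprod : (∏ i, -(deriv G (∑ j, (k * Real.log (x j) + C j)) * k / x i ^ 2)) ≠ 0 :=
      Finset.prod_ne_zero_iff.mpr fun i _ =>
        neg_ne_zero.mpr (div_ne_zero (mul_ne_zero (hG' _).ne' hk) (pow_ne_zero 2 (hx i).ne'))
    rw [hsum x hx, det_hessian_comp_sum_log hf' hGdiff hGdiff2 hG' hx, mul_eq_zero,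
      or_iff_right hprod, sub_eq_zero, eq_div_iff hnk, mul_comm, eq_comm]
  refine ⟨forall₂_congr hiff, fun hdet => ?_⟩
  have hode : ∀ u, deriv (deriv G) u = deriv G u / (n * k) := by
    intro u
    have hx : ∀ _ : Fin n, 0 < Real.exp ((u - ∑ j, C j) / (n * k)) := fun _ => Real.exp_pos _
    have hu := (hiff _ hx).mp (hdet _ hx)
    have hval : ∑ j, h j (Real.exp ((u - ∑ j, C j) / (n * k))) = u := by
      rw [hsum _ hx]
      simp only [Real.log_exp, Finset.sum_add_distrib, Finset.sum_const, Finset.card_univ,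
        Fintype.card_fin, nsmul_eq_mul]
      field_simp
      ring
    rw [hval, div_eq_iff (hG' u).ne'] at hu
    rw [hu]
    ring
  refine ⟨deriv G 0, G 0 - deriv G 0 * n * k, hG' 0, fun x _ => ?_⟩
  rw [eq_exp_add_const_of_deriv_deriv hnk hGdiff hGdiff2 hode, ← mul_assoc (deriv G 0)]
end

section
/- Let n ≥ 2, let k be a nonzero real number and let G be a twice differentiable real function. If the identity (k·G''(u) − G'(u))·Σ_{i=1}^n 1/x_i² − k²·(G'(u))³·Σ_{i≠j} 1/(x_i² x_j²) = 0, with u = k·Σ_{i=1}^n ln x_i + C for a constant C, holds for all (x_1,…,x_n) ∈ ℝ_{>0}^n, then G' vanishes identically on the range of u, i.e. G is constant there. -/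
/-- The off-diagonal sum of products `1/(xᵢ²xⱼ²)` in terms of power sums. -/
lemma sum_erase_one_div_sq_mul_sq {ι : Type*} [Fintype ι] [DecidableEq ι] (x : ι → ℝ) :
    ∑ i, ∑ j ∈ Finset.univ.erase i, 1 / ((x i) ^ 2 * (x j) ^ 2) =
      (∑ i, 1 / (x i) ^ 2) ^ 2 - ∑ i, (1 / (x i) ^ 2) ^ 2 := by
  rw [sq (∑ i, 1 / (x i) ^ 2), Finset.sum_mul_sum, ← Finset.sum_sub_distrib]
  refine Finset.sum_congr rfl fun i _ => ?_
  rw [← Finset.add_sum_erase _ _ (Finset.mem_univ i), sq (1 / (x i) ^ 2), add_sub_cancel_left]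
  exact Finset.sum_congr rfl fun j _ => by rw [one_div_mul_one_div]


/-- If `(k·G''(u) − G'(u))·∑ᵢ 1/xᵢ² − k²·G'(u)³·∑_{i≠j} 1/(xᵢ²xⱼ²) = 0` holds at
`u = k·∑ᵢ ln xᵢ + C` for every point of the positive orthant, then `G'` vanishes
identically on the range of `u`. -/
theorem minimal_equation_forces_G_constant
    (n : ℕ) (hn : 2 ≤ n) (k : ℝ) (hk : k ≠ 0) (C : ℝ)
    (G : ℝ → ℝ)
    (hGdiff : Differentiable ℝ G)
    (hGdiff2 : Differentiable ℝ (deriv G))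
    (heq : ∀ x : Fin n → ℝ, (∀ j, 0 < x j) →
      (k * deriv (deriv G) (k * ∑ i, Real.log (x i) + C)
          - deriv G (k * ∑ i, Real.log (x i) + C)) * (∑ i, 1 / (x i) ^ 2)
        - k ^ 2 * (deriv G (k * ∑ i, Real.log (x i) + C)) ^ 3 *
            (∑ i, ∑ j ∈ Finset.univ.erase i, 1 / ((x i) ^ 2 * (x j) ^ 2)) = 0) :
    ∀ x : Fin n → ℝ, (∀ j, 0 < x j) →
      deriv G (k * ∑ i, Real.log (x i) + C) = 0 := by
  intro x _
  obtain ⟨m, rfl⟩ : ∃ m, n = m + 1 := ⟨n - 1, by omega⟩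
  have hm : (0 : ℝ) < m := by exact_mod_cast (by omega : 0 < m)
  set L := ∑ i, Real.log (x i)
  set c := Real.exp (L / (m + 1))
  have hc0 : 0 < c := Real.exp_pos _
  have hlogc : Real.log c = L / (m + 1) := Real.log_exp _
  have hsum_const : ∑ _i : Fin (m + 1), Real.log c = L := by
    simp only [Finset.sum_const, Finset.card_univ, Fintype.card_fin, nsmul_eq_mul, hlogc]
    push_cast
    field_simp
  have hconst := heq (fun _ => c) fun _ => hc0
  let z : Fin (m + 1) → ℝ := Fin.cons (c / 2 ^ m) fun _ => 2 * c
  have hz : ∀ j, 0 < z j := by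
    intro j
    refine Fin.cases ?_ (fun i => ?_) j
    · simp only [z, Fin.cons_zero]
      positivity
    · simp only [z, Fin.cons_succ]
      positivity
  have hsum_z : ∑ i, Real.log (z i) = L := by
    simp only [z, Fin.sum_univ_succ, Fin.cons_zero, Fin.cons_succ, Finset.sum_const,
      Finset.card_univ, Fintype.card_fin, nsmul_eq_mul]
    rw [Real.log_div hc0.ne' (by positivity), Real.log_pow, Real.log_mul two_ne_zero hc0.ne',
      hlogc]
    field_simp
    ring
  have hpert := heq z hz
  rw [sum_erase_one_div_sq_mul_sq, hsum_const] at hconst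
  rw [sum_erase_one_div_sq_mul_sq, hsum_z] at hpert
  have hhead : 1 / (c / 2 ^ m) ^ 2 = (1 / c ^ 2) * 4 ^ m := by
    rw [div_pow, ← pow_mul, mul_comm m 2, pow_mul]
    norm_num
    ring
  have htail : 1 / (2 * c) ^ 2 = (1 / c ^ 2) / 4 := by
    field_simp
    norm_num
  simp only [z, Fin.sum_univ_succ, Fin.cons_zero, Fin.cons_succ, Finset.sum_const,
    Finset.card_univ, Fintype.card_fin, nsmul_eq_mul, hhead, htail] at hpert
  simp only [Finset.sum_const, Finset.card_univ, Fintype.card_fin, nsmul_eq_mul,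
    Nat.cast_add, Nat.cast_one] at hconst
  have hs : 0 < 1 / c ^ 2 := by positivity
  have hP : (0 : ℝ) < 4 ^ m := by positivity
  generalize 1 / c ^ 2 = s at hconst hpert hs
  generalize (4 : ℝ) ^ m = P at hpert hP
  generalize k * deriv (deriv G) (k * L + C) - deriv G (k * L + C) = A at hconst hpert
  generalize deriv G (k * L + C) = g at hconst hpert ⊢
  have hA : A = k ^ 2 * g ^ 3 * m * s := by
    have h : ((m + 1) * s) * (A - k ^ 2 * g ^ 3 * m * s) = 0 := by linear_combination hconst
    exact sub_eq_zero.mp ((mul_eq_zero.mp h).resolve_left (by positivity))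
  have h : g ^ 3 * (k ^ 2 * m * s ^ 2 * (P / 2 + 3 * m / 16 + 1 / 16)) = 0 := by
    rw [hA] at hpert
    linear_combination hpert
  exact pow_eq_zero_iff three_ne_zero |>.mp ((mul_eq_zero.mp h).resolve_right (by positivity))
end

section
/- Let n ≥ 2 and let f : ℝ_{>0}^n → ℝ_{>0} be a quasi-sum production function, f(x_1,…,x_n) = G(h_1(x_1)+…+h_n(x_n)), where G and the h_j are twice differentiable strictly monotone real functions with G' > 0, and suppose f satisfies the proportional marginal rate of substitution property. Then (∂²f/∂x_i²)(∂²f/∂x_j²) − (∂²f/∂x_i∂x_j)² = 0 holds identically on ℝ_{>0}^n for all i ≠ j (equivalently, by the graph formula K_{ij} = (f_{x_ix_i}f_{x_jx_j} − f_{x_ix_j}²)/(w²(1 + f_{x_i}² + f_{x_j}²)), the production hypersurface has vanishing sectional curvatures K_{ij}) if and only if there exist constants A > 0 and D ∈ ℝ such that f(x_1,…,x_n) = A·∏_{i=1}^n √(x_i) + D, i.e. up to a translation f is the generalized Cobb–Douglas production function A·∏_{i=1}^n x_i^{1/2}. -/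
section

open Finset

variable {n : ℕ}

lemma update_pos_of_pos {x : Fin n → ℝ} (hx : ∀ j, 0 < x j) (i : Fin n) {t : ℝ} (ht : 0 < t) :
    ∀ j, 0 < Function.update x i t j := by
  intro j
  by_cases hj : j = i
  · subst hj; simpa using ht
  · simpa [hj] using hx j

/-- Partial derivatives on the positive orthant only depend on the function there. -/
lemma pd_congr_of_pos {f g : (Fin n → ℝ) → ℝ} (hfg : ∀ x, (∀ j, 0 < x j) → f x = g x)
    {x : Fin n → ℝ} (hx : ∀ j, 0 < x j) (i : Fin n) : pd f i x = pd g i x := by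
  refine Filter.EventuallyEq.deriv_eq ?_
  filter_upwards [lt_mem_nhds (hx i)] with t ht
  exact hfg _ (update_pos_of_pos hx i ht)

lemma hasDerivAt_sum_update {h : Fin n → ℝ → ℝ} {x : Fin n → ℝ} {i : Fin n} {h' : ℝ}
    (hh : HasDerivAt (h i) h' (x i)) :
    HasDerivAt (fun t => ∑ j, h j (Function.update x i t j)) h' (x i) := by
  have key : (fun t => ∑ j, h j (Function.update x i t j)) =
      fun t => h i t + ∑ j ∈ univ.erase i, h j (x j) := by
    funext t
    rw [← add_sum_erase univ _ (mem_univ i), Function.update_self]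
    congr 1
    refine sum_congr rfl fun j hj => ?_
    rw [Function.update_of_ne (ne_of_mem_erase hj)]
  rw [key]
  exact hh.add_const _

lemma hasDerivAt_comp_sum_update {F : ℝ → ℝ} (hF : Differentiable ℝ F) {h : Fin n → ℝ → ℝ}
    {x : Fin n → ℝ} {i : Fin n} {h' : ℝ} (hh : HasDerivAt (h i) h' (x i)) :
    HasDerivAt (fun t => F (∑ j, h j (Function.update x i t j)))
      (deriv F (∑ j, h j (x j)) * h') (x i) := by
  have h1 := hasDerivAt_sum_update hh
  have h2 : HasDerivAt F (deriv F (∑ j, h j (x j)))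
      (∑ j, h j (Function.update x i (x i) j)) := by
    simpa using (hF (∑ j, h j (x j))).hasDerivAt
  exact h2.comp (x i) h1

lemma pd_of_eq_comp_sum {f : (Fin n → ℝ) → ℝ} {F : ℝ → ℝ} (hF : Differentiable ℝ F)
    {h : Fin n → ℝ → ℝ} (hf : ∀ x, (∀ j, 0 < x j) → f x = F (∑ j, h j (x j)))
    {x : Fin n → ℝ} (hx : ∀ j, 0 < x j) {i : Fin n} (hh : DifferentiableAt ℝ (h i) (x i)) :
    pd f i x = deriv F (∑ j, h j (x j)) * deriv (h i) (x i) := by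
  rw [pd_congr_of_pos hf hx i]
  exact (hasDerivAt_comp_sum_update hF hh.hasDerivAt).deriv

lemma pd_of_eq_comp_sum_log {f : (Fin n → ℝ) → ℝ} {F : ℝ → ℝ} (hF : Differentiable ℝ F)
    (hf : ∀ x : Fin n → ℝ, (∀ j, 0 < x j) → f x = F (∑ j, Real.log (x j)))
    {x : Fin n → ℝ} (hx : ∀ j, 0 < x j) (i : Fin n) :
    pd f i x = deriv F (∑ j, Real.log (x j)) * (x i)⁻¹ := by
  rw [pd_of_eq_comp_sum (h := fun _ => Real.log) hF hf hx
    (Real.differentiableAt_log (hx i).ne'), Real.deriv_log]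

lemma pd2_self_of_eq_comp_sum_log {f : (Fin n → ℝ) → ℝ} {F : ℝ → ℝ} (hF : Differentiable ℝ F)
    (hF' : Differentiable ℝ (deriv F))
    (hf : ∀ x : Fin n → ℝ, (∀ j, 0 < x j) → f x = F (∑ j, Real.log (x j)))
    {x : Fin n → ℝ} (hx : ∀ j, 0 < x j)
    (i : Fin n) :
    pd2 f i i x = (deriv (deriv F) (∑ j, Real.log (x j)) - deriv F (∑ j, Real.log (x j))) /
      (x i) ^ 2 := by
  unfold pd2
  rw [pd_congr_of_pos (fun y hy => pd_of_eq_comp_sum_log hF hf hy i) hx i]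
  have h1 := hasDerivAt_comp_sum_update (h := fun _ => Real.log) hF'
    (Real.hasDerivAt_log (hx i).ne')
  have h2 := h1.mul (hasDerivAt_inv (hx i).ne')
  have hxi := (hx i).ne'
  simp only [pd, Function.update_self]
  refine h2.deriv.trans ?_
  simp only [Function.update_eq_self]
  field_simp
  ring

lemma pd2_of_ne_of_eq_comp_sum_log {f : (Fin n → ℝ) → ℝ} {F : ℝ → ℝ} (hF : Differentiable ℝ F)
    (hF' : Differentiable ℝ (deriv F))
    (hf : ∀ x : Fin n → ℝ, (∀ j, 0 < x j) → f x = F (∑ j, Real.log (x j)))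
    {x : Fin n → ℝ} (hx : ∀ j, 0 < x j)
    {i j : Fin n} (hij : i ≠ j) :
    pd2 f i j x = deriv (deriv F) (∑ j, Real.log (x j)) / (x i * x j) := by
  unfold pd2
  rw [pd_congr_of_pos (fun y hy => pd_of_eq_comp_sum_log hF hf hy i) hx j]
  have h1 := hasDerivAt_comp_sum_update (h := fun _ => Real.log) hF'
    (Real.hasDerivAt_log (hx j).ne')
  have h2 := h1.mul_const (x i)⁻¹
  have hxi := (hx i).ne'
  have hxj := (hx j).ne'
  simp only [pd, Function.update_of_ne hij]
  refine h2.deriv.trans ?_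
  field_simp

lemma hessian_minor_of_eq_comp_sum_log {f : (Fin n → ℝ) → ℝ} {F : ℝ → ℝ} (hF : Differentiable ℝ F)
    (hF' : Differentiable ℝ (deriv F))
    (hf : ∀ x : Fin n → ℝ, (∀ j, 0 < x j) → f x = F (∑ j, Real.log (x j)))
    {x : Fin n → ℝ} (hx : ∀ j, 0 < x j)
    {i j : Fin n} (hij : i ≠ j) :
    pd2 f i i x * pd2 f j j x - (pd2 f i j x) ^ 2 =
      deriv F (∑ j, Real.log (x j)) *
        (deriv F (∑ j, Real.log (x j)) - 2 * deriv (deriv F) (∑ j, Real.log (x j))) /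
          (x i * x j) ^ 2 := by
  rw [pd2_self_of_eq_comp_sum_log hF hF' hf hx, pd2_self_of_eq_comp_sum_log hF hF' hf hx,
    pd2_of_ne_of_eq_comp_sum_log hF hF' hf hx hij]
  have hxi := (hx i).ne'
  have hxj := (hx j).ne'
  field_simp
  ring

/-- Solutions of `F' = 2 F''`. -/
lemma exists_eq_exp_half_of_deriv {F : ℝ → ℝ} (hF : Differentiable ℝ F)
    (hF' : Differentiable ℝ (deriv F)) (hode : ∀ u, deriv F u = 2 * deriv (deriv F) u) :
    ∃ A D : ℝ, ∀ u, F u = A * Real.exp (u / 2) + D := by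
  have hexp (a u : ℝ) : HasDerivAt (fun u => Real.exp (u * a)) (Real.exp (u * a) * a) u := by
    simpa using ((hasDerivAt_id u).mul_const a).exp
  have h1 (u : ℝ) : deriv F u * Real.exp (u * (-1 / 2)) = deriv F 0 := by
    have hd (u : ℝ) : HasDerivAt (fun u => deriv F u * Real.exp (u * (-1 / 2))) 0 u := by
      refine ((hF' u).hasDerivAt.mul (hexp (-1 / 2) u)).congr_deriv ?_
      rw [hode u]
      ring
    simpa using is_const_of_deriv_eq_zero (fun u => (hd u).differentiableAt)
      (fun u => (hd u).deriv) u 0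
  have h2 (u : ℝ) : deriv F u = deriv F 0 * Real.exp (u * (1 / 2)) := by
    rw [← h1 u, mul_assoc, ← Real.exp_add]
    ring_nf
    simp
  refine ⟨2 * deriv F 0, F 0 - 2 * deriv F 0, fun u => ?_⟩
  have hd (u : ℝ) : HasDerivAt
      (fun u => F u - 2 * deriv F 0 * Real.exp (u * (1 / 2))) 0 u := by
    refine ((hF u).hasDerivAt.sub ((hexp (1 / 2) u).const_mul (2 * deriv F 0))).congr_deriv ?_
    rw [h2 u]
    ring
  have h3 := is_const_of_deriv_eq_zero (fun u => (hd u).differentiableAt)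
    (fun u => (hd u).deriv) u 0
  simp only [zero_mul, Real.exp_zero, mul_one] at h3
  rw [div_eq_mul_one_div u 2]
  linarith

lemma deriv_eq_two_mul_deriv_deriv_exp_half {F : ℝ → ℝ} {A D : ℝ}
    (hF : ∀ u, F u = A * Real.exp (u / 2) + D) (u : ℝ) :
    deriv F u = 2 * deriv (deriv F) u := by
  have hexp (u : ℝ) : HasDerivAt (fun u => Real.exp (u / 2)) (Real.exp (u / 2) * (1 / 2)) u :=
    ((hasDerivAt_id u).div_const 2).exp
  have h1 : deriv F = fun u => A * (Real.exp (u / 2) * (1 / 2)) := by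
    funext v
    rw [funext hF]
    exact (((hexp v).const_mul A).add_const D).deriv
  have h2 : deriv (deriv F) u = A * (Real.exp (u / 2) * (1 / 2) * (1 / 2)) := by
    rw [h1]
    exact (((hexp u).mul_const (1 / 2)).const_mul A).deriv
  rw [h2, h1]
  ring

lemma prod_sqrt_eq_exp_half_sum_log {x : Fin n → ℝ} (hx : ∀ j, 0 < x j) :
    ∏ i, Real.sqrt (x i) = Real.exp ((∑ j, Real.log (x j)) / 2) := by
  rw [sum_div, Real.exp_sum]
  refine prod_congr rfl fun i _ => ?_
  rw [Real.exp_half, Real.exp_log (hx i)]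

lemma exists_pos_sum_log_eq (hn : n ≠ 0) (u : ℝ) :
    ∃ x : Fin n → ℝ, (∀ j, 0 < x j) ∧ ∑ j, Real.log (x j) = u := by
  refine ⟨fun _ => Real.exp (u / n), fun _ => Real.exp_pos _, ?_⟩
  have : (n : ℝ) ≠ 0 := by exact_mod_cast hn
  simp
  field_simp

lemma eq_mul_log_add_of_deriv {h : ℝ → ℝ} {c : ℝ} (hd : ∀ t, 0 < t → DifferentiableAt ℝ h t)
    (hc : ∀ t, 0 < t → t * deriv h t = c) {t : ℝ} (ht : 0 < t) :
    h t = c * Real.log t + h 1 := by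
  have hder (s : ℝ) : HasDerivAt (fun s => h (Real.exp s) - c * s) 0 s := by
    have h1 := (hd _ (Real.exp_pos s)).hasDerivAt.comp s (Real.hasDerivAt_exp s)
    refine (h1.sub ((hasDerivAt_id s).const_mul c)).congr_deriv ?_
    rw [← hc _ (Real.exp_pos s)]
    ring
  have h2 := is_const_of_deriv_eq_zero (fun s => (hder s).differentiableAt)
    (fun s => (hder s).deriv) (Real.log t) 0
  simp only [Real.exp_log ht, Real.exp_zero, mul_zero] at h2
  linarith

/-- If all cross ratios `g j t / g i s` equal `s / t`, the functions `t * g j t` are one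
nonzero constant. -/
lemma exists_mul_eq_const_of_div_eq (hn : 2 ≤ n) {g : Fin n → ℝ → ℝ}
    (hg : ∀ i j, i ≠ j → ∀ s t, 0 < s → 0 < t → g j t / g i s = s / t) :
    ∃ c : ℝ, c ≠ 0 ∧ ∀ j t, 0 < t → t * g j t = c := by
  have key (i j : Fin n) (hij : i ≠ j) (s t : ℝ) (hs : 0 < s) (ht : 0 < t) :
      g i s ≠ 0 ∧ t * g j t = s * g i s := by
    have h1 := hg i j hij s t hs ht
    have hne : g i s ≠ 0 := by
      intro h0
      rw [h0, div_zero] at h1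
      exact (div_pos hs ht).ne h1
    refine ⟨hne, ?_⟩
    rw [div_eq_div_iff hne ht.ne'] at h1
    linarith
  let i₀ : Fin n := ⟨0, by lia⟩
  let i₁ : Fin n := ⟨1, by lia⟩
  have h01 : i₀ ≠ i₁ := by simp [i₀, i₁]
  refine ⟨1 * g i₀ 1, ?_, fun j t ht => ?_⟩
  · simpa using (key i₀ i₁ h01 1 1 one_pos one_pos).1
  · by_cases hj : i₀ = j
    · subst hj
      rw [(key i₁ i₀ h01.symm 1 t one_pos ht).2, (key i₀ i₁ h01 1 1 one_pos one_pos).2]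
    · exact (key i₀ j hj 1 t one_pos ht).2

/-- The proportional marginal rate of substitution property forces a quasi-sum to be a function
of `∑ log xⱼ`. -/
lemma exists_eq_comp_sum_log (hn : 2 ≤ n) {G : ℝ → ℝ} {h : Fin n → ℝ → ℝ}
    {f : (Fin n → ℝ) → ℝ}
    (hf : ∀ x : Fin n → ℝ, (∀ j, 0 < x j) → f x = G (∑ j, h j (x j)))
    (hGdiff : Differentiable ℝ G) (hG' : ∀ u : ℝ, 0 < deriv G u)
    (hhdiff : ∀ j, ∀ t : ℝ, 0 < t → DifferentiableAt ℝ (h j) t)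
    (hMRS : ∀ x : Fin n → ℝ, (∀ j, 0 < x j) → ∀ i j : Fin n, i ≠ j →
        pd f j x / pd f i x = x i / x j) :
    ∃ c d : ℝ, c ≠ 0 ∧ ∀ x : Fin n → ℝ, (∀ j, 0 < x j) →
      f x = G (c * ∑ j, Real.log (x j) + d) := by
  obtain ⟨c, hc0, hc⟩ := exists_mul_eq_const_of_div_eq hn (g := fun j => deriv (h j)) (by
    intro i j hij s t hs ht
    have hx : ∀ k, 0 < Function.update (fun _ : Fin n => s) j t k :=
      update_pos_of_pos (fun _ => hs) j ht
    have h1 := hMRS _ hx i j hij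
    rw [pd_of_eq_comp_sum hGdiff hf hx (hhdiff _ _ (hx _)),
      pd_of_eq_comp_sum hGdiff hf hx (hhdiff _ _ (hx _)),
      mul_div_mul_left _ _ (hG' _).ne'] at h1
    simpa [Function.update_of_ne hij] using h1)
  refine ⟨c, ∑ j, h j 1, hc0, fun x hx => ?_⟩
  rw [hf x hx, mul_sum, ← sum_add_distrib]
  congr 1
  exact sum_congr rfl fun j _ => eq_mul_log_add_of_deriv (hhdiff j) (hc j) (hx j)

/-- A nonconstant function `A * exp (u / 2) + D` that is positive everywhere has `A > 0`. -/
lemma pos_of_exp_half_pos {A D : ℝ} (hA : A ≠ 0)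
    (hpos : ∀ u : ℝ, 0 < A * Real.exp (u / 2) + D) : 0 < A := by
  by_contra hle
  have hneg : A < 0 := lt_of_le_of_ne (not_lt.mp hle) hA
  have hE : 0 < |D| / (-A) + 1 := by
    have : 0 ≤ |D| / (-A) := div_nonneg (abs_nonneg _) (by linarith)
    linarith
  have h1 := hpos (2 * Real.log (|D| / (-A) + 1))
  rw [mul_div_cancel_left₀ _ two_ne_zero, Real.exp_log hE] at h1
  have h2 : A * (|D| / (-A) + 1) = -|D| + A := by
    field_simp
  linarith [le_abs_self D]

end

/-- A quasi-sum production function satisfying the proportional marginal rate of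
substitution property satisfies `f_{xᵢxᵢ}f_{xⱼxⱼ} − f_{xᵢxⱼ}² = 0` identically for all
`i ≠ j` (equivalently, the production hypersurface has vanishing sectional curvatures)
iff, up to a translation, it reduces to `f(x) = A·∏ᵢ √xᵢ + D`. -/
theorem quasiSum_proportionalMRS_vanishing_sectional_iff
    (n : ℕ) (hn : 2 ≤ n)
    (G : ℝ → ℝ) (h : Fin n → ℝ → ℝ) (f : (Fin n → ℝ) → ℝ)
    (hf : ∀ x : Fin n → ℝ, (∀ j, 0 < x j) → f x = G (∑ j, h j (x j)))
    (hfpos : ∀ x : Fin n → ℝ, (∀ j, 0 < x j) → 0 < f x)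
    (hGdiff : Differentiable ℝ G)
    (hGdiff2 : Differentiable ℝ (deriv G))
    (hGmono : StrictMono G)
    (hG' : ∀ u : ℝ, 0 < deriv G u)
    (hhdiff : ∀ j, ∀ t : ℝ, 0 < t → DifferentiableAt ℝ (h j) t)
    (hhdiff2 : ∀ j, ∀ t : ℝ, 0 < t → DifferentiableAt ℝ (deriv (h j)) t)
    (hhmono : ∀ j, StrictMonoOn (h j) (Set.Ioi 0) ∨ StrictAntiOn (h j) (Set.Ioi 0))
    (hMRS : ∀ x : Fin n → ℝ, (∀ j, 0 < x j) → ∀ i j : Fin n, i ≠ j →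
        pd f j x / pd f i x = x i / x j) :
    (∀ x : Fin n → ℝ, (∀ j, 0 < x j) → ∀ i j : Fin n, i ≠ j →
        pd2 f i i x * pd2 f j j x - (pd2 f i j x) ^ 2 = 0)
      ↔ ∃ A D : ℝ, 0 < A ∧ ∀ x : Fin n → ℝ, (∀ j, 0 < x j) →
          f x = A * (∏ i, Real.sqrt (x i)) + D := by
  obtain ⟨c, d, hc0, hlog⟩ := exists_eq_comp_sum_log hn hf hGdiff hG' hhdiff hMRS
  have hn0 : n ≠ 0 := by lia
  obtain ⟨F, hFdef⟩ : ∃ F : ℝ → ℝ, F = fun u => G (c * u + d) := ⟨_, rfl⟩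
  have hd (u : ℝ) : HasDerivAt (fun u => c * u + d) c u := by
    simpa using ((hasDerivAt_id u).const_mul c).add_const d
  have hFd (u : ℝ) : HasDerivAt F (deriv G (c * u + d) * c) u := by
    rw [hFdef]
    exact (hGdiff (c * u + d)).hasDerivAt.comp u (hd u)
  have hF : Differentiable ℝ F := fun u => (hFd u).differentiableAt
  have hderiv : deriv F = fun u => deriv G (c * u + d) * c := funext fun u => (hFd u).deriv
  have hF' : Differentiable ℝ (deriv F) := by
    rw [hderiv]
    exact fun u =>
      ((hGdiff2 (c * u + d)).comp u (hd u).differentiableAt).mul_const c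
  have hne (u : ℝ) : deriv F u ≠ 0 := by
    rw [hderiv]
    exact mul_ne_zero (hG' _).ne' hc0
  have hfF : ∀ x : Fin n → ℝ, (∀ j, 0 < x j) → f x = F (∑ j, Real.log (x j)) := by
    simpa only [hFdef] using hlog
  constructor
  · intro hK
    obtain ⟨A, D, hAD⟩ := exists_eq_exp_half_of_deriv hF hF' (by
      intro u
      obtain ⟨x, hx, rfl⟩ := exists_pos_sum_log_eq hn0 u
      have hij : (⟨0, by lia⟩ : Fin n) ≠ ⟨1, by lia⟩ := by simp
      have h1 := hK x hx _ _ hij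
      rw [hessian_minor_of_eq_comp_sum_log hF hF' hfF hx hij, div_eq_zero_iff] at h1
      have h2 := (mul_eq_zero.mp (h1.resolve_right
        (pow_ne_zero 2 (mul_pos (hx _) (hx _)).ne'))).resolve_left (hne _)
      linarith)
    have hA : A ≠ 0 := by
      rintro rfl
      refine hne 0 ?_
      simp [funext hAD]
    refine ⟨A, D, pos_of_exp_half_pos (D := D) hA fun u => ?_, fun x hx => ?_⟩
    · obtain ⟨x, hx, rfl⟩ := exists_pos_sum_log_eq hn0 u
      rw [← hAD, ← hfF x hx]
      exact hfpos x hx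
    · rw [hfF x hx, hAD, prod_sqrt_eq_exp_half_sum_log hx]
  · rintro ⟨A, D, -, hAD⟩ x hx i j hij
    have hFexp (u : ℝ) : F u = A * Real.exp (u / 2) + D := by
      obtain ⟨y, hy, rfl⟩ := exists_pos_sum_log_eq hn0 u
      rw [← hfF y hy, hAD y hy, prod_sqrt_eq_exp_half_sum_log hy]
    rw [hessian_minor_of_eq_comp_sum_log hF hF' hfF hx hij,
      deriv_eq_two_mul_deriv_deriv_exp_half hFexp (∑ j, Real.log (x j))]
    simp
end

section
/- Let n ≥ 2, let k be a nonzero real number, and let F be a differentiable strictly monotone real function with F' > 0 such that f(x_1,…,x_n) = F(∏_{i=1}^n x_i^k) is positive on ℝ_{>0}^n. Then f satisfies the proportional marginal rate of substitution property: (∂f/∂x_j)/(∂f/∂x_i) = x_i/x_j for all 1 ≤ i ≠ j ≤ n and all x ∈ ℝ_{>0}^n. -/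
/-- For positive `x`, the generalized Cobb–Douglas product has `i`-th partial derivative
`k * (∏ l, x l ^ k) / x i`. -/
theorem hasDerivAt_prod_rpow_update {n : ℕ} (k : ℝ) {x : Fin n → ℝ} (hx : ∀ l, 0 < x l)
    (i : Fin n) :
    HasDerivAt (fun t => ∏ l, Function.update x i t l ^ k) (k * (∏ l, x l ^ k) / x i) (x i) := by
  have hprod : ∀ t, ∏ l, Function.update x i t l ^ k
      = t ^ k * ∏ l ∈ Finset.univ.erase i, x l ^ k := by
    intro t
    rw [← Finset.mul_prod_erase _ _ (Finset.mem_univ i), Function.update_self]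
    congr 1
    refine Finset.prod_congr rfl fun l hl => ?_
    rw [Function.update_of_ne (Finset.ne_of_mem_erase hl)]
  simp only [hprod]
  refine ((Real.hasDerivAt_rpow_const (p := k) (Or.inl (hx i).ne')).mul_const
    (∏ l ∈ Finset.univ.erase i, x l ^ k)).congr_deriv ?_
  rw [← Finset.mul_prod_erase _ _ (Finset.mem_univ i), Real.rpow_sub_one (hx i).ne']
  ring

/-- The partial derivatives of a function that equals `F (∏ l, x l ^ k)` on the positive
orthant. -/
theorem pd_eq_of_eq_comp_prod_rpow {n : ℕ} {k : ℝ} {F : ℝ → ℝ} {f : (Fin n → ℝ) → ℝ}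
    (hf : ∀ x : Fin n → ℝ, (∀ l, 0 < x l) → f x = F (∏ l, x l ^ k))
    {x : Fin n → ℝ} (hx : ∀ l, 0 < x l) (hF : DifferentiableAt ℝ F (∏ l, x l ^ k))
    (i : Fin n) :
    pd f i x = deriv F (∏ l, x l ^ k) * (k * (∏ l, x l ^ k) / x i) := by
  have heq : (fun t => f (Function.update x i t)) =ᶠ[nhds (x i)]
      fun t => F (∏ l, Function.update x i t l ^ k) := by
    filter_upwards [lt_mem_nhds (hx i)] with t ht
    refine hf _ fun l => ?_
    rcases eq_or_ne l i with rfl | hl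
    · rwa [Function.update_self]
    · rw [Function.update_of_ne hl]
      exact hx l
  rw [pd, heq.deriv_eq]
  exact (hF.hasDerivAt.comp_of_eq (x i) (hasDerivAt_prod_rpow_update k hx i)
    (by rw [Function.update_eq_self])).deriv

/-- The homothetic generalized Cobb–Douglas function `f(x) = F(∏ᵢ xᵢᵏ)`, with `k ≠ 0` and
`F` differentiable strictly monotone with `F' > 0`, satisfies the proportional marginal
rate of substitution property `MRS_{ij} = xᵢ/xⱼ`. -/
theorem homotheticCobbDouglas_proportionalMRS
    (n : ℕ) (hn : 2 ≤ n) (k : ℝ) (hk : k ≠ 0)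
    (F : ℝ → ℝ)
    (hFdiff : ∀ u : ℝ, 0 < u → DifferentiableAt ℝ F u)
    (hFmono : StrictMonoOn F (Set.Ioi 0))
    (hF' : ∀ u : ℝ, 0 < u → 0 < deriv F u)
    (f : (Fin n → ℝ) → ℝ)
    (hf : ∀ x : Fin n → ℝ, (∀ j, 0 < x j) → f x = F (∏ i, (x i) ^ k))
    (hfpos : ∀ x : Fin n → ℝ, (∀ j, 0 < x j) → 0 < f x) :
    ∀ x : Fin n → ℝ, (∀ j, 0 < x j) → ∀ i j : Fin n, i ≠ j →
      pd f j x / pd f i x = x i / x j := by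
  intro x hx i j _
  have hP : 0 < ∏ l, x l ^ k := Finset.prod_pos fun l _ => Real.rpow_pos_of_pos (hx l) k
  rw [pd_eq_of_eq_comp_prod_rpow hf hx (hFdiff _ hP),
    pd_eq_of_eq_comp_prod_rpow hf hx (hFdiff _ hP)]
  have hF := (hF' _ hP).ne'
  have hi := (hx i).ne'
  have hj := (hx j).ne'
  have hP0 := hP.ne'
  field_simp
end
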